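/- Let (R, m) be a commutative local ring and let r ≥ 2. Let (x₀, …, x_r) be a unimodular row over the formal Laurent series ring R((t)). Then there exist a matrix M ∈ GL_{r+1}(R((t))) and a unimodular row (p₀, …, p_r) over the Laurent polynomial ring R[t,t⁻¹] such that the image of (p₀, …, p_r) in R((t))^{r+1} equals (x₀, …, x_r)·M, where moreover p₀ is a Weierstrass polynomial in R[t] and p_i lies in R[t] for all i ≥ 1. -/

import Mathlib

open Polynomial

/-- Unimodular row: the entries generate the unit ideal. -/
def IsUnimodular {A : Type} [CommRing A] {n : ℕ} (v : Fin n → A) : Prop :=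
  Ideal.span (Set.range v) = ⊤

/-- A Weierstrass polynomial over a local ring: monic, with all lower coefficients in the
maximal ideal. -/
def IsWeierstrass {R : Type} [CommRing R] [IsLocalRing R] (p : Polynomial R) : Prop :=
  p.Monic ∧ ∀ i < p.natDegree, p.coeff i ∈ IsLocalRing.maximalIdeal R

/-- The canonical ring homomorphism `R[t] → R((t))`. -/
noncomputable def polyToLaurentSeries (R : Type) [CommRing R] :
    Polynomial R →+* LaurentSeries R :=
  (HahnSeries.ofPowerSeries ℤ R).comp Polynomial.coeToPowerSeries.ringHom

/-- Coefficientwise reduction of Laurent series modulo the maximal ideal. -/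
noncomputable def redLaurent (R : Type) [CommRing R] [IsLocalRing R] :
    LaurentSeries R →+* LaurentSeries (IsLocalRing.ResidueField R) where
  toFun x := HahnSeries.map x (IsLocalRing.residue R)
  map_one' := HahnSeries.map_one (IsLocalRing.residue R).toMonoidWithZeroHom
  map_mul' x y :=
    HahnSeries.map_mul (IsLocalRing.residue R).toNonUnitalRingHom (x := x) (y := y)
  map_zero' := by ext; simp
  map_add' _ _ := by ext; simp

theorem redLaurent_coeff {R : Type} [CommRing R] [IsLocalRing R] (x : LaurentSeries R) (n : ℤ) :
    (redLaurent R x).coeff n = IsLocalRing.residue R (x.coeff n) := rfl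

theorem redLaurent_surjective (R : Type) [CommRing R] [IsLocalRing R] :
    Function.Surjective (redLaurent R) := by
  intro y
  classical
  have hs : ∀ a : IsLocalRing.ResidueField R, ∃ b : R,
      IsLocalRing.residue R b = a ∧ (a = 0 → b = 0) := by
    intro a
    by_cases h : a = 0
    · exact ⟨0, by simp [h], fun _ => rfl⟩
    · obtain ⟨b, hb⟩ := IsLocalRing.residue_surjective (R := R) a
      exact ⟨b, hb, fun h' => absurd h' h⟩
  choose s hs1 hs2 using hs
  refine ⟨⟨fun n => s (y.coeff n), y.isPWO_support.mono ?_⟩, ?_⟩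
  · intro n hn h0
    exact hn (hs2 _ h0)
  · ext n
    rw [redLaurent_coeff]
    exact hs1 _

/-- A Weierstrass polynomial and a polynomial with constant coefficient one are comaximal. -/
theorem one_mem_of_weierstrass {R : Type} [CommRing R] [IsLocalRing R] (p g : R[X])
    (hp : IsWeierstrass p) (hd : 0 < p.natDegree) (hg : g.coeff 0 = 1) (I : Ideal R[X]) (hpI : p ∈ I)
    (hgI : g ∈ I) : I = ⊤ := by
  by_contra hI
  obtain ⟨P, hP, hIP⟩ := Ideal.exists_le_maximal I hI
  have hpP := hIP hpI
  have hfin := hp.1.finite_quotient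
  have hle : Ideal.span {p} ≤ P := by
    rw [Ideal.span_le]; simpa using hpP
  have : Module.Finite R (R[X] ⧸ P) :=
    Module.Finite.of_surjective (Ideal.Quotient.factorₐ R hle).toLinearMap
      (Ideal.Quotient.factor_surjective hle)
  let : Field (R[X] ⧸ P) := Ideal.Quotient.field P
  have hmax := Ideal.isMaximal_comap_of_isIntegral_of_isMaximal (R := R) (S := R[X] ⧸ P) ⊥
  have hm := IsLocalRing.eq_maximalIdeal hmax
  have hC : ∀ a ∈ IsLocalRing.maximalIdeal R, C a ∈ P := by
    intro a ha
    rw [← hm, Ideal.mem_comap, Ideal.mem_bot] at ha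
    exact Ideal.Quotient.eq_zero_iff_mem.mp ha
  have hXd : (X : R[X]) ^ p.natDegree ∈ P := by
    have h := hp.1.as_sum
    have h2 : (X : R[X]) ^ p.natDegree
        = p - ∑ i ∈ Finset.range p.natDegree, C (p.coeff i) * X ^ i :=
      eq_sub_of_add_eq h.symm
    rw [h2]
    refine P.sub_mem hpP (P.sum_mem fun i hi => P.mul_mem_right _ (hC _ ?_))
    exact hp.2 i (Finset.mem_range.mp hi)
  have hX : (X : R[X]) ∈ P := hP.isPrime.mem_of_pow_mem _ hXd
  apply hP.ne_top
  rw [Ideal.eq_top_iff_one]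
  have h := Polynomial.X_mul_divX_add g
  rw [hg, C_1] at h
  have h1 : (1 : R[X]) = g - X * g.divX := by linear_combination h
  rw [h1]
  exact P.sub_mem (hIP hgI) (P.mul_mem_right _ hX)

/-- The rows in the orbit. -/
def OrbRel {A : Type} [CommRing A] {n : ℕ} (x y : Fin n → A) : Prop :=
  ∃ M : Matrix (Fin n) (Fin n) A, IsUnit M ∧ y = Matrix.vecMul x M

theorem OrbRel.trans {A : Type} [CommRing A] {n : ℕ} {x y z : Fin n → A}
    (h : OrbRel x y) (h' : OrbRel y z) : OrbRel x z := by
  obtain ⟨M, hM, rfl⟩ := h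
  obtain ⟨N, hN, rfl⟩ := h'
  exact ⟨M * N, hM.mul hN, by rw [Matrix.vecMul_vecMul]⟩

theorem OrbRel.refl {A : Type} [CommRing A] {n : ℕ} (x : Fin n → A) : OrbRel x x :=
  ⟨1, isUnit_one, by simp⟩

theorem OrbRel.unimodular {A : Type} [CommRing A] {n : ℕ} {x y : Fin n → A}
    (h : OrbRel x y) (hx : IsUnimodular x) : IsUnimodular y := by
  obtain ⟨M, ⟨u, rfl⟩, rfl⟩ := h
  unfold IsUnimodular at *
  rw [Ideal.eq_top_iff_one, Ideal.mem_span_range_iff_exists_fun] at *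
  obtain ⟨c, hc⟩ := hx
  refine ⟨Matrix.mulVec (↑u⁻¹ : Matrix (Fin n) (Fin n) A) c, ?_⟩
  have : (Matrix.mulVec (↑u⁻¹ : Matrix (Fin n) (Fin n) A) c) ⬝ᵥ (Matrix.vecMul x ↑u) = 1 := by
    rw [dotProduct_comm, ← Matrix.dotProduct_mulVec, Matrix.mulVec_mulVec, Units.mul_inv,
      Matrix.one_mulVec, dotProduct_comm]
    exact hc
  exact this

theorem OrbRel.add {A : Type} [CommRing A] {n : ℕ} (x : Fin n → A) (i j : Fin n) (hij : i ≠ j)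
    (c : A) : OrbRel x (Function.update x j (x j + c * x i)) := by
  refine ⟨Matrix.transvection i j c, ?_, ?_⟩
  · rw [Matrix.isUnit_iff_isUnit_det, Matrix.det_transvection_of_ne i j hij]
    exact isUnit_one
  · ext k
    rw [Matrix.transvection, Matrix.vecMul_add, Matrix.vecMul_one, Pi.add_apply]
    by_cases h : k = j
    · subst h
      simp [Matrix.vecMul, dotProduct, Matrix.single_apply, mul_comm]
    · have h' : j ≠ k := fun e => h e.symm
      simp [Matrix.vecMul, dotProduct, h, h']

theorem OrbRel.smul {A : Type} [CommRing A] {n : ℕ} (x : Fin n → A) (c : A) (hc : IsUnit c) :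
    OrbRel x (fun i => c * x i) := by
  refine ⟨c • 1, ?_, ?_⟩
  · rw [Matrix.isUnit_iff_isUnit_det, Matrix.det_smul]
    simpa using hc.pow _
  · ext k
    rw [Matrix.vecMul_smul]
    simp

/-- Step 1: make the zeroth entry vanish modulo the maximal ideal. -/
theorem exists_orb_red_zero {R : Type} [CommRing R] [IsLocalRing R]
    (r : ℕ) (hr : 2 ≤ r) (x : Fin (r + 1) → LaurentSeries R) :
    ∃ y, OrbRel x y ∧ redLaurent R (y 0) = 0 := by
  obtain ⟨s, rfl⟩ : ∃ s, r = s + 1 := ⟨r - 1, by omega⟩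
  have h01 : (0 : Fin (s + 1 + 1)) ≠ 1 := by simp
  have key : ∀ z : Fin (s + 1 + 1) → LaurentSeries R, redLaurent R (z 1) ≠ 0 →
      ∃ y, OrbRel z y ∧ redLaurent R (y 0) = 0 := by
    intro z hz
    obtain ⟨c, hc⟩ := redLaurent_surjective R (-(redLaurent R (z 0) / redLaurent R (z 1)))
    refine ⟨_, OrbRel.add z 1 0 h01.symm c, ?_⟩
    rw [Function.update_self, map_add, map_mul, hc]
    field_simp
    ring
  by_cases h0 : redLaurent R (x 0) = 0
  · exact ⟨x, OrbRel.refl x, h0⟩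
  by_cases h1 : redLaurent R (x 1) = 0
  · obtain ⟨y, hy, hy0⟩ := key (Function.update x 1 (x 1 + 1 * x 0)) (by
      rw [Function.update_self, map_add, map_mul, h1, map_one]
      simpa using h0)
    exact ⟨y, (OrbRel.add x 0 1 h01 1).trans hy, hy0⟩
  · exact key x h1

theorem isUnit_single_one (R : Type) [CommRing R] (k : ℕ) :
    IsUnit (HahnSeries.ofPowerSeries ℤ R (PowerSeries.X ^ k)) :=
  IsLocalization.map_units (M := Submonoid.powers (PowerSeries.X : PowerSeries R))
    (LaurentSeries R) ⟨PowerSeries.X ^ k, ⟨k, rfl⟩⟩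

theorem exists_clear {R : Type} [CommRing R] {n : ℕ} (x : Fin n → LaurentSeries R) :
    ∃ (k : ℕ) (f : Fin n → PowerSeries R), ∀ i, HahnSeries.ofPowerSeries ℤ R (f i) =
      HahnSeries.ofPowerSeries ℤ R (PowerSeries.X ^ k) * x i := by
  obtain ⟨⟨b, k, rfl⟩, hb⟩ := IsLocalization.exist_integer_multiples_of_finite
    (Submonoid.powers (PowerSeries.X : PowerSeries R)) x
  choose f hf using hb
  refine ⟨k, f, fun i => ?_⟩
  have := hf i
  rw [Algebra.smul_def] at this
  exact this

/-- Every power series is its truncation plus a multiple of a power of the variable. -/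
theorem exists_trunc_add {R : Type} [CommRing R] (f : PowerSeries R) (n : ℕ) :
    ∃ h : PowerSeries R, f = (PowerSeries.trunc n f : PowerSeries R) + PowerSeries.X ^ n * h := by
  have : PowerSeries.X ^ n ∣ f - (PowerSeries.trunc n f : PowerSeries R) := by
    rw [PowerSeries.X_pow_dvd_iff]
    intro m hm
    simp [PowerSeries.coeff_trunc, hm]
  obtain ⟨h, hh⟩ := this
  exact ⟨h, by rw [← hh]; ring⟩

/-- Step 2: the statement for power series rows. -/
theorem power_series_step {R : Type} [CommRing R] [IsLocalRing R] (r : ℕ)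
    (f y : Fin (r + 1) → PowerSeries R) (N : ℕ)
    (hfy : ∑ i, f i * y i = PowerSeries.X ^ N)
    (hf0 : ∀ n, PowerSeries.coeff n (f 0) ∈ IsLocalRing.maximalIdeal R) :
    ∃ (p : Fin (r + 1) → R[X]), OrbRel f (fun i => (p i : PowerSeries R)) ∧
      IsWeierstrass (p 0) ∧ IsUnimodular (fun i => Polynomial.toLaurent (p i)) := by
  classical
  have hh : ∀ i, ∃ h : PowerSeries R, f i = (PowerSeries.trunc (N + 1) (f i) : PowerSeries R)
      + PowerSeries.X ^ (N + 1) * h := fun i => exists_trunc_add _ _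
  choose h hh using hh
  let p : Fin (r + 1) → R[X] := fun i =>
    (if i = 0 then X ^ (N + 1) else 0) + PowerSeries.trunc (N + 1) (f i)
  let w : Fin (r + 1) → PowerSeries R := fun i => (if i = 0 then 1 else 0) - h i
  have hpf : ∀ i, (p i : PowerSeries R) = f i + PowerSeries.X ^ (N + 1) * w i := by
    intro i
    conv_rhs => rw [hh i]
    by_cases hi : i = 0
    · simp [p, w, hi]; ring
    · simp [p, w, hi]
  have hp0 : p 0 = X ^ (N + 1) + PowerSeries.trunc (N + 1) (f 0) := by simp [p]
  have hdeg : (PowerSeries.trunc (N + 1) (f 0)).degree < ((N + 1 : ℕ) : WithBot ℕ) :=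
    PowerSeries.degree_trunc_lt _ _
  have hnat : (p 0).natDegree = N + 1 := by
    rw [hp0, Polynomial.natDegree_add_eq_left_of_degree_lt (by simpa using hdeg),
      Polynomial.natDegree_X_pow]
  have hW : IsWeierstrass (p 0) := by
    refine ⟨by rw [hp0]; exact Polynomial.monic_X_pow_add hdeg, ?_⟩
    intro i hi
    rw [hnat] at hi
    rw [hp0, Polynomial.coeff_add, Polynomial.coeff_X_pow, if_neg hi.ne, zero_add,
      PowerSeries.coeff_trunc, if_pos hi]
    exact hf0 i
  refine ⟨p, ?_, hW, ?_⟩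
  · refine ⟨1 + Matrix.vecMulVec y (fun i => PowerSeries.X * w i), ?_, ?_⟩
    · rw [Matrix.isUnit_iff_isUnit_det, PowerSeries.isUnit_iff_constantCoeff, RingHom.map_det]
      have : (PowerSeries.constantCoeff (R := R)).mapMatrix
          (1 + Matrix.vecMulVec y (fun i => PowerSeries.X * w i)) = 1 := by
        rw [map_add, map_one, add_eq_left]
        ext i j
        simp [Matrix.vecMulVec_apply]
      rw [this]
      simp
    · ext1 i
      rw [Matrix.vecMul_add, Matrix.vecMul_one, Pi.add_apply, Matrix.vecMul_vecMulVec, hpf]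
      have : f ⬝ᵥ y = PowerSeries.X ^ N := hfy
      simp [this, pow_succ, mul_assoc]
  · -- unimodularity
    let q : R[X] := ∑ i, p i * PowerSeries.trunc (N + 1) (y i)
    have hz : ∀ i, ∃ z : PowerSeries R, y i = (PowerSeries.trunc (N + 1) (y i) : PowerSeries R)
        + PowerSeries.X ^ (N + 1) * z := fun i => exists_trunc_add _ _
    choose z hz using hz
    have hq : (q : PowerSeries R) = PowerSeries.X ^ N + PowerSeries.X ^ (N + 1) *
        (∑ i, (w i * y i - p i * z i)) := by
      have e : (q : PowerSeries R) = ∑ i, (p i : PowerSeries R) *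
          (PowerSeries.trunc (N + 1) (y i) : PowerSeries R) := by
        have := map_sum (Polynomial.coeToPowerSeries.ringHom (R := R))
          (fun i => p i * PowerSeries.trunc (N + 1) (y i)) Finset.univ
        simp only [map_mul] at this
        exact this
      rw [e, ← hfy, Finset.mul_sum, ← Finset.sum_add_distrib]
      refine Finset.sum_congr rfl fun i _ => ?_
      have h1 := hpf i
      have h2 := hz i
      linear_combination (y i) * h1 - (p i : PowerSeries R) * h2
    have hco : ∀ m, q.coeff m = PowerSeries.coeff m (q : PowerSeries R) := by
      intro m; simp
    have hdvd : X ^ N ∣ q := by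
      rw [Polynomial.X_pow_dvd_iff]
      intro m hm
      rw [hco, hq, map_add, PowerSeries.coeff_X_pow, if_neg hm.ne, PowerSeries.coeff_X_pow_mul',
        if_neg (by omega), add_zero]
    obtain ⟨g, hg⟩ := hdvd
    have hg0 : g.coeff 0 = 1 := by
      have h1 : q.coeff N = 1 := by
        rw [hco, hq, map_add, PowerSeries.coeff_X_pow, if_pos rfl, PowerSeries.coeff_X_pow_mul',
          if_neg (by omega), add_zero]
      rw [hg, Polynomial.coeff_X_pow_mul'] at h1
      simpa using h1
    unfold IsUnimodular
    set J := Ideal.span (Set.range fun i => Polynomial.toLaurent (p i)) with hJ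
    have hpJ : ∀ i, Polynomial.toLaurent (p i) ∈ J := fun i => Ideal.subset_span ⟨i, rfl⟩
    have hqJ : Polynomial.toLaurent q ∈ J := by
      simp only [q, map_sum, map_mul]
      exact J.sum_mem fun i _ => J.mul_mem_right _ (hpJ i)
    have hgJ : Polynomial.toLaurent g ∈ J := by
      rw [hg, map_mul, Polynomial.toLaurent_X_pow] at hqJ
      exact (Ideal.unit_mul_mem_iff_mem J (LaurentPolynomial.isUnit_T _)).mp hqJ
    have htop := one_mem_of_weierstrass (p 0) g hW (by omega) hg0
      (J.comap (Polynomial.toLaurent : R[X] →+* _)) (hpJ 0) hgJ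
    exact Ideal.comap_eq_top_iff.mp htop

theorem OrbRel.map {A B : Type} [CommRing A] [CommRing B] (φ : A →+* B) {n : ℕ} {x y : Fin n → A}
    (h : OrbRel x y) : OrbRel (fun i => φ (x i)) (fun i => φ (y i)) := by
  obtain ⟨M, hM, rfl⟩ := h
  refine ⟨φ.mapMatrix M, hM.map φ.mapMatrix, ?_⟩
  ext1 i
  simp [Matrix.vecMul, dotProduct]

/-- **Lemma (reduction step).** Let `(R, m)` be a commutative local ring, `r ≥ 2`, and
`(x₀, …, x_r)` a unimodular row over `R((t))`.  Then there are an invertible matrix `M` over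
`R((t))` and polynomials `p₀, …, p_r ∈ R[t]` forming a unimodular row over the Laurent
polynomial ring `R[t,t⁻¹]`, such that the image of `(p₀, …, p_r)` in `R((t))^{r+1}` equals
`(x₀, …, x_r)·M`, and `p₀` is a Weierstrass polynomial. -/
theorem exists_laurentPolynomial_row_in_orbit (R : Type) [CommRing R] [IsLocalRing R]
    (r : ℕ) (hr : 2 ≤ r) (x : Fin (r + 1) → LaurentSeries R) (hx : IsUnimodular x) :
    ∃ (M : Matrix (Fin (r + 1)) (Fin (r + 1)) (LaurentSeries R))
      (p : Fin (r + 1) → Polynomial R),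
      IsUnit M ∧
      IsUnimodular (fun i => Polynomial.toLaurent (p i)) ∧
      IsWeierstrass (p 0) ∧
      ∀ i, polyToLaurentSeries R (p i) = Matrix.vecMul x M i := by
  obtain ⟨x', hxx', hx'0⟩ := exists_orb_red_zero r hr x
  obtain ⟨k, f, hf⟩ := exists_clear x'
  have horb : OrbRel x (fun i => HahnSeries.ofPowerSeries ℤ R (f i)) := by
    have h := hxx'.trans (OrbRel.smul x' _ (isUnit_single_one R k))
    simpa only [← hf] using h
  have huni := horb.unimodular hx
  unfold IsUnimodular at huni
  rw [Ideal.eq_top_iff_one, Ideal.mem_span_range_iff_exists_fun] at huni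
  obtain ⟨c, hc⟩ := huni
  obtain ⟨N, y, hy⟩ := exists_clear c
  have hfy : ∑ i, f i * y i = PowerSeries.X ^ N := by
    apply HahnSeries.ofPowerSeries_injective (Γ := ℤ) (R := R)
    rw [map_sum, ← mul_one (HahnSeries.ofPowerSeries ℤ R (PowerSeries.X ^ N)), ← hc,
      Finset.mul_sum]
    refine Finset.sum_congr rfl fun i _ => ?_
    rw [map_mul, hy]
    ring
  have hf0 : ∀ n, PowerSeries.coeff n (f 0) ∈ IsLocalRing.maximalIdeal R := by
    intro n
    have h : redLaurent R (HahnSeries.ofPowerSeries ℤ R (f 0)) = 0 := by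
      rw [hf, map_mul, hx'0, mul_zero]
    have h2 := congrArg (fun s => HahnSeries.coeff s (n : ℤ)) h
    simp only [redLaurent_coeff, HahnSeries.coeff_zero] at h2
    rw [LaurentSeries.coeff_coe_powerSeries] at h2
    exact (IsLocalRing.residue_eq_zero_iff _).mp h2
  obtain ⟨p, hp, hW, hU⟩ := power_series_step r f y N hfy hf0
  obtain ⟨M, hM, hMp⟩ := horb.trans (hp.map (HahnSeries.ofPowerSeries ℤ R))
  exact ⟨M, p, hM, hU, hW, fun i => congrFun hMp i⟩
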